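/- arXiv:2403.13224 — 2 statements merged into one kernel-verified Lean document; each statement's English description precedes it below -/
import Mathlib

section
/- Let n ≥ 1 and let u ∈ ℝ^{n+1} be a unit vector with all entries nonzero. Suppose y : ℝ → ℝ is continuous on E_u, even (y(−x) = y(x)), satisfies y(0) = 0, and satisfies Φ_u(x, y(x)) = 0 for every x ∈ D_u. Then F_u is integrable on ℝ, the function s ↦ F_u(s + i·y(s)) is integrable on E_u, and ∫_{−∞}^{+∞} F_u(t) dt = ∫_{E_u} F_u(s + i·y(s)) ds. -/
open MeasureTheory

/-- The function `F_u(t) = ∏ j, e^{i u_j t} / (1 + i u_j t)`. -/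
noncomputable def Fchar {m : ℕ} (u : Fin m → ℝ) (t : ℂ) : ℂ :=
  ∏ j, Complex.exp (Complex.I * u j * t) / (1 + Complex.I * u j * t)

/-- The continuous inverse cotangent with range `(0, π)`. -/
noncomputable def arccot (θ : ℝ) : ℝ := Real.pi / 2 - Real.arctan θ

/-- The lifting `Φ_u(x, y)` of the argument of `F_u(x + iy)` (for `x > 0`). -/
noncomputable def Phi {m : ℕ} (u : Fin m → ℝ) (x y : ℝ) : ℝ :=
  x * ∑ j, u j
    - ∑ j ∈ Finset.univ.filter (fun j => 0 < u j), arccot ((1 / u j - y) / x)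
    + ∑ j ∈ Finset.univ.filter (fun j => u j < 0), arccot (-(1 / u j - y) / x)

/-- The domain `D_u`. -/
noncomputable def Dset {m : ℕ} (u : Fin m → ℝ) : Set ℝ :=
  {x | 0 < x ∧
    -(((Finset.univ.filter (fun j => u j < 0)).card : ℝ) * Real.pi) < x * ∑ j, u j ∧
    x * ∑ j, u j < ((Finset.univ.filter (fun j => 0 < u j)).card : ℝ) * Real.pi}

/-- The extended (symmetric) domain `E_u`. -/
noncomputable def Eset {m : ℕ} (u : Fin m → ℝ) : Set ℝ :=
  {x | x = 0 ∨ x ∈ Dset u ∨ -x ∈ Dset u}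
section

open Set Filter Topology

lemma Phi_eq {m : ℕ} (u : Fin m → ℝ) (hnz : ∀ j, u j ≠ 0) (x y : ℝ) :
    Phi u x y = ∑ j, (u j * x - arccot ((1 / u j - y) / x) +
      if u j < 0 then Real.pi else 0) := by
  have h : ∀ j, (u j * x - arccot ((1 / u j - y) / x) + if u j < 0 then Real.pi else 0) =
      x * u j - (if 0 < u j then arccot ((1 / u j - y) / x) else 0)
        + (if u j < 0 then arccot (-(1 / u j - y) / x) else 0) := by
    intro j
    rcases lt_or_gt_of_ne (hnz j) with h | h
    · simp only [h, not_lt.2 h.le, if_true, if_false, arccot, neg_div, Real.arctan_neg]; ring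
    · simp only [h, not_lt.2 h.le, if_true, if_false]; ring
  rw [Finset.sum_congr rfl fun j _ => h j, Finset.sum_add_distrib, Finset.sum_sub_distrib,
    ← Finset.mul_sum, Phi, Finset.sum_filter, Finset.sum_filter]

lemma cast_add_I_eq_exp_arccot (a : ℝ) :
    (a : ℂ) + Complex.I = (√(1 + a ^ 2) : ℝ) * Complex.exp (Complex.I * (arccot a : ℝ)) := by
  have h : (0 : ℝ) < √(1 + a ^ 2) := Real.sqrt_pos.2 (by positivity)
  rw [mul_comm Complex.I, Complex.exp_mul_I, ← Complex.ofReal_cos, ← Complex.ofReal_sin, arccot,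
    Real.cos_pi_div_two_sub, Real.sin_pi_div_two_sub, Real.sin_arctan, Real.cos_arctan]
  apply Complex.ext
  · simp; field_simp
  · simp; field_simp

lemma exists_factor_eq {u x : ℝ} (hu : u ≠ 0) (hx : 0 < x) (y : ℝ) :
    ∃ r : ℝ, 0 ≤ r ∧
      Complex.exp (Complex.I * u * (x + Complex.I * y)) / (1 + Complex.I * u * (x + Complex.I * y))
        = r * Complex.exp (Complex.I * ((u * x - arccot ((1 / u - y) / x) +
          if u < 0 then Real.pi else 0 : ℝ) : ℂ)) := by
  set a := (1 / u - y) / x with ha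
  have hs : (0 : ℝ) < √(1 + a ^ 2) := Real.sqrt_pos.2 (by positivity)
  have hden : 1 + Complex.I * u * (x + Complex.I * y) = (u * x : ℝ) * (a + Complex.I) := by
    have : u * x * a = 1 - u * y := by rw [ha]; field_simp
    push_cast
    have h2 : (u : ℂ) * x * a = 1 - u * y := by exact_mod_cast this
    linear_combination -h2 + u * y * Complex.I_sq
  have hnum : Complex.exp (Complex.I * u * (x + Complex.I * y)) =
      (Real.exp (-(u * y)) : ℝ) * Complex.exp (Complex.I * (u * x : ℝ)) := by
    rw [Complex.ofReal_exp, ← Complex.exp_add]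
    congr 1
    push_cast
    linear_combination u * y * Complex.I_sq
  refine ⟨Real.exp (-(u * y)) / (|u| * x * √(1 + a ^ 2)), by positivity, ?_⟩
  rw [hden, hnum, cast_add_I_eq_exp_arccot, Complex.ofReal_add, Complex.ofReal_sub, mul_add,
    Complex.exp_add, mul_sub, Complex.exp_sub]
  have hx' : (x : ℂ) ≠ 0 := by exact_mod_cast hx.ne'
  have hu' : (u : ℂ) ≠ 0 := by exact_mod_cast hu
  have hs' : ((√(1 + a ^ 2) : ℝ) : ℂ) ≠ 0 := by exact_mod_cast hs.ne'
  rcases lt_or_gt_of_ne hu with h | h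
  · rw [if_pos h, abs_of_neg h, mul_comm Complex.I (Real.pi : ℂ), Complex.exp_pi_mul_I]
    push_cast
    field_simp
  · rw [if_neg (not_lt.2 h.le), abs_of_pos h]
    push_cast
    simp
    field_simp

lemma exists_Fchar_eq_of_Phi_eq_zero {m : ℕ} {u : Fin m → ℝ} (hnz : ∀ j, u j ≠ 0) {x y : ℝ}
    (hx : 0 < x) (h : Phi u x y = 0) :
    ∃ r : ℝ, 0 ≤ r ∧ Fchar u (x + Complex.I * y) = r := by
  choose r hr hF using fun j => exists_factor_eq (hnz j) hx y
  refine ⟨∏ j, r j, Finset.prod_nonneg fun j _ => hr j, ?_⟩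
  rw [Fchar, Finset.prod_congr rfl fun j _ => hF j, Finset.prod_mul_distrib, ← Complex.exp_sum,
    ← Finset.mul_sum, ← Complex.ofReal_sum, ← Phi_eq u hnz, h]
  simp

lemma hasDerivAt_Phi_snd {m : ℕ} {u : Fin m → ℝ} (hnz : ∀ j, u j ≠ 0) (x y : ℝ) :
    HasDerivAt (Phi u x) (∑ j, -(1 / (1 + ((1 / u j - y) / x) ^ 2) / x)) y := by
  rw [funext fun y => Phi_eq u hnz x y]
  refine HasDerivAt.fun_sum fun j _ => ?_
  have h1 : HasDerivAt (fun y : ℝ => (1 / u j - y) / x) (-1 / x) y :=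
    ((hasDerivAt_id y).const_sub (1 / u j)).div_const x
  have := ((h1.arctan.const_sub (Real.pi / 2)).const_sub (u j * x)).add_const
    (if u j < 0 then Real.pi else 0)
  refine this.congr_deriv ?_
  ring

lemma Phi_deriv_neg {m : ℕ} [NeZero m] (u : Fin m → ℝ) {x : ℝ} (hx : 0 < x) (y : ℝ) :
    ∑ j, -(1 / (1 + ((1 / u j - y) / x) ^ 2) / x) < 0 :=
  Finset.sum_neg (fun j _ => by simp only [Left.neg_neg_iff]; positivity) Finset.univ_nonempty

lemma Phi_strictAnti {m : ℕ} [NeZero m] {u : Fin m → ℝ} (hnz : ∀ j, u j ≠ 0) {x : ℝ}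
    (hx : 0 < x) : StrictAnti (Phi u x) :=
  strictAnti_of_hasDerivAt_neg (fun y => hasDerivAt_Phi_snd hnz x y) fun y => Phi_deriv_neg u hx y

lemma contDiffAt_Phi {m : ℕ} {u : Fin m → ℝ} (hnz : ∀ j, u j ≠ 0) {p : ℝ × ℝ}
    (hp : 0 < p.1) : ContDiffAt ℝ 1 (fun p : ℝ × ℝ => Phi u p.1 p.2) p := by
  rw [funext fun p : ℝ × ℝ => Phi_eq u hnz p.1 p.2]
  refine ContDiffAt.sum fun j _ => ?_
  unfold arccot
  have h1 : ContDiffAt ℝ 1 (fun p : ℝ × ℝ => (1 / u j - p.2) / p.1) p :=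
    (contDiffAt_const.sub contDiffAt_snd).div contDiffAt_fst hp.ne'
  exact ((contDiffAt_const.mul contDiffAt_fst).sub (contDiffAt_const.sub h1.arctan)).add
    contDiffAt_const

lemma differentiableAt_of_Phi_eq_zero {m : ℕ} [NeZero m] {u : Fin m → ℝ} (hnz : ∀ j, u j ≠ 0)
    {y : ℝ → ℝ} {x : ℝ} (hx : 0 < x) (hy : ContinuousAt y x)
    (h : ∀ᶠ s in 𝓝 x, Phi u s (y s) = 0) : DifferentiableAt ℝ y x := by
  have hc := contDiffAt_Phi (p := (x, y x)) hnz hx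
  have hs := hc.hasStrictFDerivAt one_ne_zero
  set f' := fderiv ℝ (fun p : ℝ × ℝ => Phi u p.1 p.2) (x, y x)
  have h1 : HasDerivAt (Phi u x) (f' (0, 1)) (y x) := by
    have := hs.hasFDerivAt.comp_hasDerivAt (y x)
      ((hasDerivAt_const (y x) x).prodMk (hasDerivAt_id (y x)))
    exact this
  have hne : f' (0, 1) ≠ 0 := by
    rw [h1.unique (hasDerivAt_Phi_snd hnz x (y x))]
    exact (Phi_deriv_neg u hx _).ne
  have hinv : (f' ∘L .inr ℝ ℝ ℝ).IsInvertible := by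
    refine ⟨ContinuousLinearEquiv.unitsEquivAut ℝ (Units.mk0 _ hne), ?_⟩
    ext
    simp
  have he := hs.eventually_apply_eq_iff_implicitFunctionOfProdDomain hinv
  have ht : Tendsto (fun s => (s, y s)) (𝓝 x) (𝓝 (x, y x)) := continuousAt_id.prodMk hy
  have hd := (hs.hasStrictFDerivAt_implicitFunctionOfProdDomain hinv).hasFDerivAt.differentiableAt
  refine hd.congr_of_eventuallyEq ?_
  filter_upwards [ht.eventually he, h] with s h1 h2
  exact (h1.1 (by simp only [h2, h.self_of_nhds])).symm

lemma norm_one_add_sq (u : ℝ) (t : ℂ) :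
    ‖1 + Complex.I * u * t‖ ^ 2 = (1 - u * t.im) ^ 2 + (u * t.re) ^ 2 := by
  rw [Complex.sq_norm, Complex.normSq_apply]
  simp
  ring

lemma exists_le_norm_one_add {m : ℕ} [NeZero m] {u : Fin m → ℝ} (hnz : ∀ j, u j ≠ 0)
    (hu1 : ∀ j, |u j| ≤ 1) {ρ : ℝ} (hρ : 0 < ρ) :
    ∃ c : ℝ, 0 < c ∧ ∀ t : ℂ, 0 ≤ t.re → (ρ ≤ t.re ∨ |t.im| ≤ 1 / 2) →
      ∀ j, c * (1 + t.re) ≤ ‖1 + Complex.I * u j * t‖ := by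
  obtain ⟨k, hk⟩ := Finite.exists_min fun j => |u j|
  refine ⟨|u k| * min (ρ / (1 + ρ)) (1 / 3), mul_pos (abs_pos.2 (hnz k)) (by positivity), ?_⟩
  intro t ht0 ht j
  have hsq := norm_one_add_sq (u j) t
  have hre : |u j| * t.re ≤ ‖1 + Complex.I * u j * t‖ := by
    apply le_of_sq_le_sq _ (norm_nonneg _)
    rw [hsq, mul_pow, sq_abs, mul_pow]
    nlinarith [sq_nonneg (1 - u j * t.im)]
  have hj : |u k| * min (ρ / (1 + ρ)) (1 / 3) * (1 + t.re) ≤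
      |u j| * min (ρ / (1 + ρ)) (1 / 3) * (1 + t.re) := by
    exact mul_le_mul_of_nonneg_right
      (mul_le_mul_of_nonneg_right (hk j) (by positivity)) (by positivity)
  refine hj.trans ?_
  rcases ht with h | h
  · have h1 : ρ / (1 + ρ) * (1 + t.re) ≤ t.re := by
      rw [div_mul_eq_mul_div, div_le_iff₀ (by positivity)]
      nlinarith
    calc |u j| * min (ρ / (1 + ρ)) (1 / 3) * (1 + t.re)
        ≤ |u j| * (ρ / (1 + ρ)) * (1 + t.re) := by gcongr; exact min_le_left _ _
      _ ≤ |u j| * t.re := by rw [mul_assoc]; gcongr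
      _ ≤ _ := hre
  · have h1 : |u j * t.im| ≤ 1 / 2 := by
      rw [abs_mul]
      nlinarith [hu1 j, abs_nonneg (u j), abs_nonneg t.im]
    have h2 : 1 / 2 ≤ ‖1 + Complex.I * u j * t‖ := by
      apply le_of_sq_le_sq _ (norm_nonneg _)
      rw [hsq]
      nlinarith [sq_nonneg (u j * t.re), abs_le.1 h1]
    calc |u j| * min (ρ / (1 + ρ)) (1 / 3) * (1 + t.re)
        ≤ |u j| * (1 / 3) * (1 + t.re) := by gcongr; exact min_le_right _ _
      _ ≤ _ := by nlinarith [hu1 j]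

lemma norm_exp_I_mul (u : ℝ) (t : ℂ) :
    ‖Complex.exp (Complex.I * u * t)‖ = Real.exp (-(u * t.im)) := by
  rw [Complex.norm_exp]
  simp

lemma exists_norm_Fchar_le {m : ℕ} (hm : 2 ≤ m) {u : Fin m → ℝ} (hnz : ∀ j, u j ≠ 0)
    (hu1 : ∀ j, |u j| ≤ 1) {ρ : ℝ} (hρ : 0 < ρ) :
    ∃ C : ℝ, 0 < C ∧ ∀ t : ℂ, 0 ≤ t.re → (ρ ≤ t.re ∨ |t.im| ≤ 1 / 2) →
      ‖Fchar u t‖ ≤ Real.exp (-((∑ j, u j) * t.im)) * C * ((1 + t.re) ^ 2)⁻¹ := by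
  have : NeZero m := ⟨by omega⟩
  obtain ⟨c, hc, h⟩ := exists_le_norm_one_add hnz hu1 hρ
  refine ⟨(c ^ m)⁻¹, by positivity, fun t ht0 ht => ?_⟩
  have hprod : (c * (1 + t.re)) ^ m ≤ ∏ j, ‖1 + Complex.I * u j * t‖ := by
    have := Finset.prod_le_prod (s := Finset.univ) (f := fun _ : Fin m => c * (1 + t.re))
      (g := fun j => ‖1 + Complex.I * u j * t‖) (fun j _ => by positivity) (fun j _ => h t ht0 ht j)
    simpa using this
  rw [Fchar, Finset.prod_div_distrib, norm_div, norm_prod, norm_prod]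
  simp only [norm_exp_I_mul]
  rw [← Real.exp_sum, Finset.sum_neg_distrib, ← Finset.sum_mul, mul_assoc, div_eq_mul_inv]
  gcongr
  rw [← mul_inv]
  gcongr
  calc c ^ m * (1 + t.re) ^ 2 ≤ c ^ m * (1 + t.re) ^ m := by
        gcongr
        linarith
    _ ≤ _ := by rwa [← mul_pow]

lemma one_add_ne_zero {u : ℝ} (hu1 : |u| ≤ 1) {t : ℂ} (h : t.re ≠ 0 ∨ |t.im| ≤ 1 / 2) :
    1 + Complex.I * u * t ≠ 0 := by
  intro h0
  have hsq := norm_one_add_sq u t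
  rw [h0, norm_zero] at hsq
  have h1 : 1 - u * t.im = 0 := by nlinarith [sq_nonneg (1 - u * t.im), sq_nonneg (u * t.re)]
  have h2 : u * t.re = 0 := by nlinarith [sq_nonneg (1 - u * t.im), sq_nonneg (u * t.re)]
  rcases h with h | h
  · rcases mul_eq_zero.1 h2 with h3 | h3
    · simp [h3] at h1
    · exact h h3
  · have : |u * t.im| ≤ 1 / 2 := by
      rw [abs_mul]
      nlinarith [abs_nonneg u, abs_nonneg t.im]
    have := (abs_le.1 this).2
    linarith

lemma differentiableAt_Fchar {m : ℕ} {u : Fin m → ℝ} (hu1 : ∀ j, |u j| ≤ 1) {t : ℂ}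
    (h : t.re ≠ 0 ∨ |t.im| ≤ 1 / 2) : DifferentiableAt ℂ (Fchar u) t := by
  unfold Fchar
  refine DifferentiableAt.fun_finsetProd fun j _ => ?_
  refine DifferentiableAt.div (by fun_prop) (by fun_prop) (one_add_ne_zero (hu1 j) h)

lemma measurable_Fchar {m : ℕ} (u : Fin m → ℝ) : Measurable (Fchar u) := by
  unfold Fchar
  fun_prop

lemma hasDerivAt_neg_inv_add {a s : ℝ} (h : a + s ≠ 0) :
    HasDerivAt (fun s : ℝ => -(a + s)⁻¹) (((a + s) ^ 2)⁻¹) s := by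
  have := (((hasDerivAt_id s).const_add a).inv h).neg
  refine this.congr_deriv ?_
  simp
  ring

lemma tendsto_neg_inv_add (a : ℝ) : Tendsto (fun s : ℝ => -(a + s)⁻¹) atTop (𝓝 0) := by
  simpa using (tendsto_inv_atTop_zero.comp (tendsto_atTop_add_const_left atTop a tendsto_id)).neg

lemma integrableOn_inv_add_sq {a : ℝ} (ha : 0 < a) :
    IntegrableOn (fun s : ℝ => ((a + s) ^ 2)⁻¹) (Ioi 0) :=
  integrableOn_Ioi_deriv_of_nonneg'
    (fun s hs => hasDerivAt_neg_inv_add (by have : 0 ≤ s := hs; positivity))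
    (fun s _ => by positivity) (tendsto_neg_inv_add a)

lemma integral_inv_add_sq {a : ℝ} (ha : 0 < a) :
    ∫ s in Ioi (0 : ℝ), ((a + s) ^ 2)⁻¹ = a⁻¹ := by
  rw [integral_Ioi_of_hasDerivAt_of_nonneg'
    (fun s hs => hasDerivAt_neg_inv_add (by have : 0 ≤ s := hs; positivity))
    (fun s _ => by positivity) (tendsto_neg_inv_add a)]
  simp

/-- The antiderivative of `Fchar u` on the right half plane that vanishes at `+∞`. -/
noncomputable def Fprim {m : ℕ} (u : Fin m → ℝ) (t : ℂ) : ℂ :=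
  -∫ s in Ioi (0 : ℝ), Fchar u (t + s)

lemma aestronglyMeasurable_Fchar_add {m : ℕ} (u : Fin m → ℝ) (t : ℂ) (μ : Measure ℝ) :
    AEStronglyMeasurable (fun s : ℝ => Fchar u (t + s)) μ :=
  ((measurable_Fchar u).comp (by fun_prop)).aestronglyMeasurable

section Bounds

variable {m : ℕ} {u : Fin m → ℝ}

lemma integrableOn_Fchar_add (hm : 2 ≤ m) (hnz : ∀ j, u j ≠ 0) (hu1 : ∀ j, |u j| ≤ 1) {t : ℂ}
    (ht0 : 0 ≤ t.re) (ht : 0 < t.re ∨ |t.im| ≤ 1 / 2) :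
    IntegrableOn (fun s : ℝ => Fchar u (t + s)) (Ioi 0) := by
  obtain ⟨ρ, hρ, ht⟩ : ∃ ρ : ℝ, 0 < ρ ∧ (ρ ≤ t.re ∨ |t.im| ≤ 1 / 2) := by
    rcases ht with h | h
    · exact ⟨_, h, .inl le_rfl⟩
    · exact ⟨1, one_pos, .inr h⟩
  obtain ⟨C, hC, h⟩ := exists_norm_Fchar_le hm hnz hu1 hρ
  refine Integrable.mono' ((integrableOn_inv_add_sq (a := 1 + t.re) (by positivity)).const_mul
    (Real.exp (-((∑ j, u j) * t.im)) * C)) (aestronglyMeasurable_Fchar_add u t _) ?_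
  refine (ae_restrict_iff' measurableSet_Ioi).2 (.of_forall fun s hs => ?_)
  have hs : 0 < s := hs
  have := h (t + s) (by simp; positivity) (by
    simp only [Complex.add_re, Complex.add_im, Complex.ofReal_re, Complex.ofReal_im, add_zero]
    exact ht.imp (fun h => by linarith) id)
  simpa [add_assoc] using this

lemma exists_norm_Fprim_le (hm : 2 ≤ m) (hnz : ∀ j, u j ≠ 0) (hu1 : ∀ j, |u j| ≤ 1) {ρ : ℝ}
    (hρ : 0 < ρ) : ∃ C : ℝ, 0 < C ∧ ∀ t : ℂ, ρ ≤ t.re →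
      ‖Fprim u t‖ ≤ Real.exp (-((∑ j, u j) * t.im)) * C * (1 + t.re)⁻¹ := by
  obtain ⟨C, hC, h⟩ := exists_norm_Fchar_le hm hnz hu1 hρ
  refine ⟨C, hC, fun t ht => ?_⟩
  have h0 : 0 < 1 + t.re := by linarith
  rw [Fprim, norm_neg, ← integral_inv_add_sq h0, ← integral_const_mul]
  refine norm_integral_le_of_norm_le ((integrableOn_inv_add_sq h0).const_mul _) ?_
  refine (ae_restrict_iff' measurableSet_Ioi).2 (.of_forall fun s hs => ?_)
  have hs : 0 < s := hs
  have := h (t + s) (by simp; linarith) (.inl (by simp; linarith))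
  simpa [add_assoc] using this

lemma continuousWithinAt_Fprim_zero (hm : 2 ≤ m) (hnz : ∀ j, u j ≠ 0) (hu1 : ∀ j, |u j| ≤ 1) :
    ContinuousWithinAt (Fprim u) {t | 0 ≤ t.re} 0 := by
  obtain ⟨C, hC, h⟩ := exists_norm_Fchar_le hm hnz hu1 one_pos
  refine Tendsto.neg ?_
  refine tendsto_integral_filter_of_dominated_convergence
    (fun s => Real.exp |∑ j, u j| * C * ((1 + s) ^ 2)⁻¹)
    (.of_forall fun t => aestronglyMeasurable_Fchar_add u t _) ?_
    ((integrableOn_inv_add_sq one_pos).const_mul _) ?_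
  · have him : ∀ᶠ t : ℂ in 𝓝[{t | 0 ≤ t.re}] 0, |t.im| < 1 / 2 := by
      apply mem_nhdsWithin_of_mem_nhds
      exact (Complex.continuous_im.abs.isOpen_preimage _ isOpen_Iio).mem_nhds (by simp)
    filter_upwards [him, self_mem_nhdsWithin] with t him ht
    refine (ae_restrict_iff' measurableSet_Ioi).2 (.of_forall fun s hs => ?_)
    have hs : 0 < s := hs
    have ht : 0 ≤ t.re := ht
    have := h (t + s) (by simp; positivity) (.inr (by simpa using him.le))
    refine this.trans ?_
    simp only [Complex.add_re, Complex.add_im, Complex.ofReal_re, Complex.ofReal_im, add_zero]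
    gcongr ?_ * _ * ((?_ ) ^ 2)⁻¹
    · apply Real.exp_le_exp.2
      calc -((∑ j, u j) * t.im) ≤ |(∑ j, u j) * t.im| := neg_le_abs _
        _ = |∑ j, u j| * |t.im| := abs_mul _ _
        _ ≤ |∑ j, u j| * 1 := by gcongr; linarith
        _ = _ := mul_one _
    · linarith
  · refine (ae_restrict_iff' measurableSet_Ioi).2 (.of_forall fun s hs => ?_)
    have hs : 0 < s := hs
    have hc : ContinuousAt (fun t : ℂ => Fchar u (t + s)) 0 := by
      refine ContinuousAt.comp (g := Fchar u) ?_ (by fun_prop)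
      exact (differentiableAt_Fchar hu1 (.inr (by simp))).continuousAt
    exact hc.tendsto.mono_left nhdsWithin_le_nhds

lemma hasDerivAt_Fprim (hm : 2 ≤ m) (hnz : ∀ j, u j ≠ 0) (hu1 : ∀ j, |u j| ≤ 1) {t₀ : ℂ}
    (ht₀ : 0 < t₀.re) : HasDerivAt (Fprim u) (Fchar u t₀) t₀ := by
  set ρ := t₀.re / 3 with hρ
  have hρ0 : 0 < ρ := by positivity
  obtain ⟨C, hC, h⟩ := exists_norm_Fchar_le hm hnz hu1 hρ0
  set M := Real.exp (|∑ j, u j| * (|t₀.im| + 2 * ρ)) * C with hM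
  have hdiff : ∀ t : ℂ, 0 < t.re → ∀ s : ℝ, 0 ≤ s →
      HasDerivAt (fun t : ℂ => Fchar u (t + s)) (deriv (Fchar u) (t + s)) t := by
    intro t ht s hs
    refine HasDerivAt.comp_add_const t (s : ℂ) ?_
    exact (differentiableAt_Fchar hu1 (.inl (by simp; positivity))).hasDerivAt
  have hre : ∀ t ∈ Metric.ball t₀ ρ, 2 * ρ < t.re := by
    intro t ht
    have h1 := (Complex.abs_re_le_norm (t - t₀)).trans_lt (mem_ball_iff_norm.1 ht)
    have h2 := (abs_lt.1 h1).1
    simp only [Complex.sub_re] at h2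
    linarith
  have hbound : ∀ s : ℝ, 0 < s → ∀ t ∈ Metric.ball t₀ ρ,
      ‖deriv (Fchar u) (t + s)‖ ≤ M / ρ * ((1 + s) ^ 2)⁻¹ := by
    intro s hs t ht
    have hz : ∀ z ∈ Metric.closedBall (t + (s : ℂ)) ρ,
        ρ + s < z.re ∧ |z.im| ≤ |t₀.im| + 2 * ρ := by
      intro z hz
      have h1 := mem_closedBall_iff_norm.1 hz
      have h2 := (abs_le.1 ((Complex.abs_re_le_norm _).trans h1)).1
      have h3 := abs_le.1 ((Complex.abs_im_le_norm _).trans h1)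
      have h4 := abs_le.1 ((Complex.abs_im_le_norm _).trans (mem_ball_iff_norm.1 ht).le)
      have h5 := hre t ht
      simp only [Complex.sub_re, Complex.add_re, Complex.ofReal_re, Complex.sub_im,
        Complex.add_im, Complex.ofReal_im] at h2 h3 h4
      refine ⟨by linarith, abs_le.2 ⟨?_, ?_⟩⟩
      · linarith [neg_abs_le t₀.im]
      · linarith [le_abs_self t₀.im]
    have := Complex.norm_deriv_le_of_forall_mem_sphere_norm_le (c := t + (s : ℂ)) (R := ρ)
      (f := Fchar u) (C := M * ((1 + s) ^ 2)⁻¹) hρ0 ?_ ?_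
    · exact this.trans_eq (by ring)
    · refine DifferentiableOn.diffContOnCl fun z hz' => ?_
      have := (hz z (Metric.closure_ball_subset_closedBall hz')).1
      exact (differentiableAt_Fchar hu1 (.inl (by linarith))).differentiableWithinAt
    · intro z hz'
      obtain ⟨h1, h2⟩ := hz z (Metric.sphere_subset_closedBall hz')
      refine (h z (by linarith) (.inl (by linarith))).trans ?_
      rw [hM]
      gcongr ?_ * _ * ((?_) ^ 2)⁻¹
      · apply Real.exp_le_exp.2
        calc -((∑ j, u j) * z.im) ≤ |(∑ j, u j) * z.im| := neg_le_abs _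
          _ = |∑ j, u j| * |z.im| := abs_mul _ _
          _ ≤ _ := by gcongr
      · linarith
  obtain ⟨hint, hd⟩ := hasDerivAt_integral_of_dominated_loc_of_deriv_le
    (μ := volume.restrict (Ioi (0 : ℝ))) (F := fun (t : ℂ) (s : ℝ) => Fchar u (t + s))
    (F' := fun (t : ℂ) (s : ℝ) => deriv (Fchar u) (t + s)) (x₀ := t₀)
    (bound := fun s : ℝ => M / ρ * ((1 + s) ^ 2)⁻¹) (Metric.ball_mem_nhds t₀ hρ0)
    (.of_forall fun t => aestronglyMeasurable_Fchar_add u t _)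
    (integrableOn_Fchar_add hm hnz hu1 ht₀.le (.inl ht₀))
    ((measurable_deriv (Fchar u)).comp (by fun_prop)).aestronglyMeasurable
    ((ae_restrict_iff' measurableSet_Ioi).2 (.of_forall fun s hs => hbound s hs))
    ((integrableOn_inv_add_sq one_pos).const_mul _)
    ((ae_restrict_iff' measurableSet_Ioi).2 (.of_forall fun s hs t ht =>
      hdiff t (by linarith [hre t ht]) s (le_of_lt hs)))
  refine hd.neg.congr_deriv ?_
  have hlim : Tendsto (fun s : ℝ => Fchar u (t₀ + s)) atTop (𝓝 0) := by
    have hz : Tendsto (fun s : ℝ => M * ((1 + s) ^ 2)⁻¹) atTop (𝓝 0) := by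
      have h1 : Tendsto (fun s : ℝ => (1 + s) ^ 2) atTop atTop :=
        (tendsto_pow_atTop two_ne_zero).comp (tendsto_atTop_add_const_left _ 1 tendsto_id)
      simpa using h1.inv_tendsto_atTop.const_mul M
    refine squeeze_zero_norm' ?_ hz
    filter_upwards [eventually_ge_atTop 0] with s hs
    refine (h (t₀ + s) (by simp; positivity) (.inl (by simp; linarith))).trans ?_
    simp only [Complex.add_re, Complex.add_im, Complex.ofReal_re, Complex.ofReal_im, add_zero]
    rw [hM]
    gcongr ?_ * _ * ((?_) ^ 2)⁻¹
    · apply Real.exp_le_exp.2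
      calc -((∑ j, u j) * t₀.im) ≤ |(∑ j, u j) * t₀.im| := neg_le_abs _
        _ = |∑ j, u j| * |t₀.im| := abs_mul _ _
        _ ≤ _ := by gcongr; linarith
    · linarith
  have := integral_Ioi_of_hasDerivAt_of_tendsto' (a := (0 : ℝ))
    (f := fun s : ℝ => Fchar u (t₀ + s)) (f' := fun s : ℝ => deriv (Fchar u) (t₀ + s))
    (fun s hs => ?_) hint hlim
  · rw [this]
    simp
  · have hs : 0 ≤ s := hs
    have h1 : HasDerivAt (Fchar u) (deriv (Fchar u) (t₀ + s)) (t₀ + s) :=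
      (differentiableAt_Fchar hu1 (.inl (by simp; positivity))).hasDerivAt
    exact (HasDerivAt.comp_const_add t₀ (s : ℂ) h1).comp_ofReal

end Bounds

lemma arccot_pos (a : ℝ) : 0 < arccot a := by
  have := Real.arctan_lt_pi_div_two a
  unfold arccot
  linarith

lemma arccot_lt_pi (a : ℝ) : arccot a < Real.pi := by
  have := Real.neg_pi_div_two_lt_arctan a
  unfold arccot
  linarith

lemma Phi_gt {m : ℕ} {u : Fin m → ℝ} (x y : ℝ)
    (h : x * ∑ j, u j = (Finset.univ.filter (fun j => 0 < u j)).card * Real.pi)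
    (hne : (Finset.univ.filter (fun j => 0 < u j)).Nonempty) : 0 < Phi u x y := by
  have h1 : ∑ j ∈ Finset.univ.filter (fun j => 0 < u j), arccot ((1 / u j - y) / x)
      < (Finset.univ.filter (fun j => 0 < u j)).card * Real.pi := by
    rw [← nsmul_eq_mul, ← Finset.sum_const]
    exact Finset.sum_lt_sum_of_nonempty hne fun j _ => arccot_lt_pi _
  have h2 : 0 ≤ ∑ j ∈ Finset.univ.filter (fun j => u j < 0), arccot (-(1 / u j - y) / x) :=
    Finset.sum_nonneg fun j _ => (arccot_pos _).le
  rw [Phi]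
  linarith

lemma Phi_lt {m : ℕ} {u : Fin m → ℝ} (x y : ℝ)
    (h : x * ∑ j, u j = -((Finset.univ.filter (fun j => u j < 0)).card * Real.pi))
    (hne : (Finset.univ.filter (fun j => u j < 0)).Nonempty) : Phi u x y < 0 := by
  have h1 : ∑ j ∈ Finset.univ.filter (fun j => u j < 0), arccot (-(1 / u j - y) / x)
      < (Finset.univ.filter (fun j => u j < 0)).card * Real.pi := by
    rw [← nsmul_eq_mul, ← Finset.sum_const]
    exact Finset.sum_lt_sum_of_nonempty hne fun j _ => arccot_lt_pi _
  have h2 : 0 ≤ ∑ j ∈ Finset.univ.filter (fun j => 0 < u j), arccot ((1 / u j - y) / x) :=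
    Finset.sum_nonneg fun j _ => (arccot_pos _).le
  rw [Phi]
  linarith

lemma continuousAt_Phi_fst {m : ℕ} {u : Fin m → ℝ} (hnz : ∀ j, u j ≠ 0) {x : ℝ} (hx : 0 < x)
    (y : ℝ) : ContinuousAt (fun x => Phi u x y) x :=
  ContinuousAt.comp (g := fun p : ℝ × ℝ => Phi u p.1 p.2) (f := fun x => (x, y))
    (contDiffAt_Phi (p := (x, y)) hnz hx).continuousAt (by fun_prop)

lemma filter_pos_nonempty {m : ℕ} {u : Fin m → ℝ} (h : 0 < ∑ j, u j) :
    (Finset.univ.filter (fun j => 0 < u j)).Nonempty := by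
  obtain ⟨j, -, hj⟩ := Finset.exists_lt_of_sum_lt (f := fun _ : Fin m => (0 : ℝ)) (g := u)
    (s := Finset.univ) (by simpa using h)
  exact ⟨j, by simpa using hj⟩

lemma filter_neg_nonempty {m : ℕ} {u : Fin m → ℝ} (h : ∑ j, u j < 0) :
    (Finset.univ.filter (fun j => u j < 0)).Nonempty := by
  obtain ⟨j, -, hj⟩ := Finset.exists_lt_of_sum_lt (f := u) (g := fun _ : Fin m => (0 : ℝ))
    (s := Finset.univ) (by simpa using h)
  exact ⟨j, by simpa using hj⟩

lemma Dset_eq_Ioi {m : ℕ} [NeZero m] {u : Fin m → ℝ} (hnz : ∀ j, u j ≠ 0) (h : ∑ j, u j = 0) :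
    Dset u = Ioi 0 := by
  have hp : (Finset.univ.filter (fun j => 0 < u j)).Nonempty := by
    by_contra hc
    have : ∀ j, u j < 0 := fun j => lt_of_le_of_ne
      (not_lt.1 fun hj => hc ⟨j, by simpa using hj⟩) (hnz j)
    exact (Finset.sum_neg (fun j _ => this j) Finset.univ_nonempty).ne h
  have hn : (Finset.univ.filter (fun j => u j < 0)).Nonempty := by
    by_contra hc
    have : ∀ j, 0 < u j := fun j => lt_of_le_of_ne
      (not_lt.1 fun hj => hc ⟨j, by simpa using hj⟩) (hnz j).symm
    exact (Finset.sum_pos (fun j _ => this j) Finset.univ_nonempty).ne' h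
  have h1 : (0 : ℝ) < (Finset.univ.filter (fun j => 0 < u j)).card := by
    exact_mod_cast hp.card_pos
  have h2 : (0 : ℝ) < (Finset.univ.filter (fun j => u j < 0)).card := by
    exact_mod_cast hn.card_pos
  ext x
  simp only [Dset, h, mul_zero, mem_ofPred_eq, mem_Ioi, and_iff_left_iff_imp]
  intro _
  have := Real.pi_pos
  exact ⟨by simp only [Left.neg_neg_iff]; positivity, by positivity⟩

lemma exists_Dset_eq_Ioo {m : ℕ} [NeZero m] {u : Fin m → ℝ} (hnz : ∀ j, u j ≠ 0)
    (h : ∑ j, u j ≠ 0) {y : ℝ → ℝ} (hy : ∀ x ∈ Dset u, Phi u x (y x) = 0) :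
    ∃ X : ℝ, 0 < X ∧ Dset u = Ioo 0 X ∧
      Tendsto (fun x => (∑ j, u j) * y x) (𝓝[<] X) atTop := by
  have hpi := Real.pi_pos
  set S := ∑ j, u j with hS
  rcases lt_or_gt_of_ne h with h | h
  · have hne := filter_neg_nonempty h
    have hc : (0 : ℝ) < (Finset.univ.filter (fun j => u j < 0)).card := by
      exact_mod_cast hne.card_pos
    set X := (Finset.univ.filter (fun j => u j < 0)).card * Real.pi / (-S) with hX
    have hS' : 0 < -S := by linarith
    have hX0 : 0 < X := by positivity
    have hXS : X * S = -((Finset.univ.filter (fun j => u j < 0)).card * Real.pi) := by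
      rw [hX]; field_simp
    have hD : Dset u = Ioo 0 X := by
      ext x
      simp only [Dset, mem_ofPred_eq, mem_Ioo, ← hS]
      constructor
      · rintro ⟨h1, h2, -⟩
        exact ⟨h1, by rw [hX, lt_div_iff₀ hS']; linarith⟩
      · rintro ⟨h1, h2⟩
        rw [hX, lt_div_iff₀ hS'] at h2
        refine ⟨h1, by linarith, lt_of_lt_of_le (mul_neg_of_pos_of_neg h1 h) (by positivity)⟩
    refine ⟨X, hX0, hD, tendsto_atTop.2 fun M => ?_⟩
    have hev := (continuousAt_Phi_fst hnz hX0 (M / S)).eventually_lt_const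
      (Phi_lt X (M / S) hXS hne)
    filter_upwards [Ioo_mem_nhdsLT hX0, mem_nhdsWithin_of_mem_nhds hev] with x hx hlt
    have hlt : Phi u x (M / S) < 0 := hlt
    rw [← hy x (hD ▸ hx), (Phi_strictAnti hnz hx.1).lt_iff_gt, lt_div_iff_of_neg h] at hlt
    linarith
  · have hne := filter_pos_nonempty h
    have hc : (0 : ℝ) < (Finset.univ.filter (fun j => 0 < u j)).card := by
      exact_mod_cast hne.card_pos
    set X := (Finset.univ.filter (fun j => 0 < u j)).card * Real.pi / S with hX
    have hX0 : 0 < X := by positivity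
    have hXS : X * S = (Finset.univ.filter (fun j => 0 < u j)).card * Real.pi := by
      rw [hX]; field_simp
    have hD : Dset u = Ioo 0 X := by
      ext x
      simp only [Dset, mem_ofPred_eq, mem_Ioo, ← hS]
      constructor
      · rintro ⟨h1, -, h2⟩
        exact ⟨h1, by rw [hX, lt_div_iff₀ h]; linarith⟩
      · rintro ⟨h1, h2⟩
        rw [hX, lt_div_iff₀ h] at h2
        refine ⟨h1, lt_of_le_of_lt ?_ (mul_pos h1 h), by linarith⟩
        rw [Left.neg_nonpos_iff]
        positivity
    refine ⟨X, hX0, hD, tendsto_atTop.2 fun M => ?_⟩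
    have hev := (continuousAt_Phi_fst hnz hX0 (M / S)).eventually_const_lt
      (Phi_gt X (M / S) hXS hne)
    filter_upwards [Ioo_mem_nhdsLT hX0, mem_nhdsWithin_of_mem_nhds hev] with x hx hlt
    have hlt : 0 < Phi u x (M / S) := hlt
    rw [← hy x (hD ▸ hx), (Phi_strictAnti hnz hx.1).lt_iff_gt, div_lt_iff₀ h] at hlt
    linarith

section Curve

variable {m : ℕ} {u : Fin m → ℝ} {y : ℝ → ℝ}

lemma hasDerivAt_re_Fprim_curve (hm : 2 ≤ m) (hnz : ∀ j, u j ≠ 0) (hu1 : ∀ j, |u j| ≤ 1)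
    (hyc : ContinuousOn y (Eset u)) (hy : ∀ x ∈ Dset u, Phi u x (y x) = 0)
    (hopen : IsOpen (Dset u)) {x : ℝ} (hx : x ∈ Dset u) :
    HasDerivAt (fun x : ℝ => (Fprim u (x + Complex.I * y x)).re)
      (Fchar u (x + Complex.I * y x)).re x := by
  have : NeZero m := ⟨by omega⟩
  have hnhds : Dset u ∈ 𝓝 x := hopen.mem_nhds hx
  have hE : Dset u ⊆ Eset u := fun s hs => Or.inr (Or.inl hs)
  have hd := (differentiableAt_of_Phi_eq_zero hnz hx.1
    (hyc.continuousAt (mem_of_superset hnhds hE)) (eventually_of_mem hnhds hy)).hasDerivAt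
  have hγ : HasDerivAt (fun s : ℝ => (s : ℂ) + Complex.I * y s)
      (1 + Complex.I * (deriv y x : ℝ)) x :=
    Complex.ofRealCLM.hasDerivAt.add (hd.ofReal_comp.const_mul Complex.I)
  have hF := (hasDerivAt_Fprim hm hnz hu1 (t₀ := x + Complex.I * y x) (by simpa using hx.1))
  have hcomp := HasDerivAt.comp x hF hγ
  have hre := Complex.reCLM.hasFDerivAt.comp_hasDerivAt x hcomp
  obtain ⟨r, -, hr⟩ := exists_Fchar_eq_of_Phi_eq_zero hnz hx.1 (hy x hx)
  refine hre.congr_deriv ?_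
  rw [hr]
  simp

lemma continuousWithinAt_Fprim_curve (hm : 2 ≤ m) (hnz : ∀ j, u j ≠ 0) (hu1 : ∀ j, |u j| ≤ 1)
    (hyc : ContinuousOn y (Eset u)) (hy0 : y 0 = 0) {X : ℝ} (hX : 0 < X)
    (hD : Ioo 0 X ⊆ Dset u) :
    ContinuousWithinAt (fun x : ℝ => (Fprim u (x + Complex.I * y x)).re) (Ici 0) 0 := by
  have hmem : Eset u ∈ 𝓝[≥] (0 : ℝ) := by
    filter_upwards [Ico_mem_nhdsGE hX] with x hx
    rcases hx.1.eq_or_lt with h | h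
    · exact Or.inl h.symm
    · exact Or.inr (Or.inl (hD ⟨h, hx.2⟩))
  have hyc0 : ContinuousWithinAt y (Ici 0) 0 :=
    (hyc 0 (Or.inl rfl)).mono_of_mem_nhdsWithin hmem
  have hγ : ContinuousWithinAt (fun s : ℝ => (s : ℂ) + Complex.I * y s) (Ici 0) 0 :=
    Complex.continuous_ofReal.continuousWithinAt.add
      (continuousWithinAt_const.mul (Complex.continuous_ofReal.continuousAt.comp_continuousWithinAt
        hyc0))
  refine Complex.continuous_re.continuousAt.comp_continuousWithinAt ?_
  refine ContinuousWithinAt.comp (t := {t | 0 ≤ t.re}) (g := Fprim u) ?_ hγ ?_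
  · simpa [hy0] using continuousWithinAt_Fprim_zero hm hnz hu1
  · intro s hs
    simpa using hs

lemma integral_re_Fchar_curve (hm : 2 ≤ m) (hnz : ∀ j, u j ≠ 0) (hu1 : ∀ j, |u j| ≤ 1)
    (hyc : ContinuousOn y (Eset u)) (hy0 : y 0 = 0) (hy : ∀ x ∈ Dset u, Phi u x (y x) = 0) :
    MeasurableSet (Dset u) ∧
    IntegrableOn (fun s : ℝ => (Fchar u (s + Complex.I * y s)).re) (Dset u) ∧
    ∫ s in Dset u, (Fchar u (s + Complex.I * y s)).re = -(Fprim u 0).re := by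
  have : NeZero m := ⟨by omega⟩
  have hpos : ∀ x ∈ Dset u, 0 ≤ (Fchar u (x + Complex.I * y x)).re := by
    intro x hx
    obtain ⟨r, hr0, hr⟩ := exists_Fchar_eq_of_Phi_eq_zero hnz hx.1 (hy x hx)
    simpa [hr] using hr0
  by_cases hS : ∑ j, u j = 0
  · have hD := Dset_eq_Ioi hnz hS
    have hderiv := fun x (hx : x ∈ Dset u) =>
      hasDerivAt_re_Fprim_curve hm hnz hu1 hyc hy (hD ▸ isOpen_Ioi) hx
    have hcont := continuousWithinAt_Fprim_curve hm hnz hu1 hyc hy0 one_pos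
      (hD ▸ fun x hx => hx.1)
    have hlim : Tendsto (fun x : ℝ => (Fprim u (x + Complex.I * y x)).re) atTop (𝓝 0) := by
      obtain ⟨C, hC, hb⟩ := exists_norm_Fprim_le hm hnz hu1 one_pos
      have hz : Tendsto (fun x : ℝ => C * (1 + x)⁻¹) atTop (𝓝 0) := by
        simpa using (tendsto_inv_atTop_zero.comp
          (tendsto_atTop_add_const_left atTop (1 : ℝ) tendsto_id)).const_mul C
      refine squeeze_zero_norm' ?_ hz
      filter_upwards [eventually_ge_atTop 1] with x hx
      refine (Complex.abs_re_le_norm _).trans ?_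
      simpa [hS] using hb (x + Complex.I * y x) (by simpa using hx)
    rw [hD] at hderiv hpos ⊢
    refine ⟨measurableSet_Ioi, integrableOn_Ioi_deriv_of_nonneg hcont hderiv hpos hlim, ?_⟩
    rw [integral_Ioi_of_hasDerivAt_of_nonneg hcont hderiv hpos hlim]
    simp [hy0]
  · obtain ⟨X, hX, hD, hlim⟩ := exists_Dset_eq_Ioo hnz hS hy
    have hderiv := fun x (hx : x ∈ Dset u) =>
      hasDerivAt_re_Fprim_curve hm hnz hu1 hyc hy (hD ▸ isOpen_Ioo) hx
    have hcont := continuousWithinAt_Fprim_curve hm hnz hu1 hyc hy0 hX hD.ge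
    have hlim : Tendsto (fun x : ℝ => (Fprim u (x + Complex.I * y x)).re) (𝓝[<] X) (𝓝 0) := by
      obtain ⟨C, hC, hb⟩ := exists_norm_Fprim_le hm hnz hu1 (half_pos hX)
      have hz : Tendsto (fun x : ℝ => Real.exp (-((∑ j, u j) * y x)) * C) (𝓝[<] X) (𝓝 0) := by
        simpa using (Real.tendsto_exp_neg_atTop_nhds_zero.comp hlim).mul_const C
      refine squeeze_zero_norm' ?_ hz
      filter_upwards [Ioo_mem_nhdsLT (half_lt_self hX)] with x hx
      have hx0 : 0 ≤ x := by linarith [hx.1]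
      refine (Complex.abs_re_le_norm _).trans ?_
      have h1 := hb (x + Complex.I * y x) (by simpa using hx.1.le)
      have h2 : (1 + x)⁻¹ ≤ 1 := inv_le_one_of_one_le₀ (by linarith)
      simp only [Complex.add_re, Complex.add_im, Complex.ofReal_re, Complex.ofReal_im,
        Complex.I_mul_re, Complex.I_mul_im, neg_zero, add_zero, zero_add] at h1
      exact h1.trans (mul_le_of_le_one_right (by positivity) h2)
    rw [hD] at hderiv hpos ⊢
    set g := Function.update (fun x : ℝ => (Fprim u (x + Complex.I * y x)).re) X 0 with hg
    have hgderiv : ∀ x ∈ Ioo 0 X, HasDerivAt g (Fchar u (x + Complex.I * y x)).re x := by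
      intro x hx
      refine (hderiv x hx).congr_of_eventuallyEq ?_
      filter_upwards [isOpen_ne.mem_nhds hx.2.ne] with s hs
      exact Function.update_of_ne hs _ _
    have hgcont : ContinuousOn g (Icc 0 X) := by
      intro x hx
      rcases hx.1.eq_or_lt with rfl | h0
      · refine (hcont.mono Icc_subset_Ici_self).congr_of_eventuallyEq ?_ ?_
        · filter_upwards [mem_nhdsWithin_of_mem_nhds (isOpen_ne.mem_nhds hX.ne)] with s hs
          exact Function.update_of_ne hs _ _
        · exact Function.update_of_ne hX.ne _ _
      · rcases hx.2.eq_or_lt with rfl | hlt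
        · rw [hg, continuousWithinAt_update_same]
          refine hlim.mono_left (nhdsWithin_mono _ ?_)
          rintro s ⟨hs, hne⟩
          exact lt_of_le_of_ne hs.2 hne
        · exact (hgderiv x ⟨h0, hlt⟩).continuousAt.continuousWithinAt
    have hint := intervalIntegral.integrableOn_deriv_of_nonneg hgcont hgderiv hpos
    refine ⟨measurableSet_Ioo, hint.mono_set Ioo_subset_Ioc_self, ?_⟩
    rw [← integral_Ioc_eq_integral_Ioo, ← intervalIntegral.integral_of_le hX.le,
      intervalIntegral.integral_eq_sub_of_hasDerivAt_of_le hX.le hgcont hgderiv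
        ((intervalIntegrable_iff_integrableOn_Ioc_of_le hX.le).2 hint)]
    simp [hg, hX.ne, hy0]

end Curve

lemma integral_of_conj_symm {f : ℝ → ℂ} (hf : ∀ x, f (-x) = (starRingEnd ℂ) (f x))
    (hint : IntegrableOn f (Ioi 0)) :
    Integrable f ∧ ∫ x, f x = ((2 * (∫ x in Ioi 0, f x).re : ℝ) : ℂ) := by
  have hconj : IntegrableOn (fun x => (starRingEnd ℂ) (f x)) (Ioi 0) :=
    Complex.conjCLE.toContinuousLinearMap.integrable_comp hint
  have hneg : IntegrableOn f (Iic 0) := by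
    have h1 : IntegrableOn (fun x => f (-x)) (Ioi 0) := by simpa only [hf] using hconj
    rw [integrableOn_Iic_iff_integrableOn_Iio]
    have := (Measure.measurePreserving_neg (volume : Measure ℝ)).integrableOn_comp_preimage
      (Homeomorph.neg ℝ).measurableEmbedding (f := f) (s := Iio 0)
    rw [← this]
    simpa [Function.comp_def] using h1
  have hfull : Integrable f := by
    rw [← integrableOn_univ, ← Iic_union_Ioi (a := (0 : ℝ))]
    exact hneg.union hint
  refine ⟨hfull, ?_⟩
  have h2 : ∫ x in Iic (0 : ℝ), f x = (starRingEnd ℂ) (∫ x in Ioi (0 : ℝ), f x) := by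
    have := integral_comp_neg_Iic (0 : ℝ) (fun x => f (-x))
    simp only [neg_neg, neg_zero] at this
    rw [this, ← integral_conj]
    simp only [hf]
  rw [← intervalIntegral.integral_Iic_add_Ioi hneg hint, h2, add_comm, Complex.add_conj]

lemma Fchar_neg_conj {m : ℕ} (u : Fin m → ℝ) (t : ℂ) :
    Fchar u (-(starRingEnd ℂ) t) = (starRingEnd ℂ) (Fchar u t) := by
  rw [Fchar, Fchar, map_prod]
  refine Finset.prod_congr rfl fun j _ => ?_
  rw [map_div₀, ← Complex.exp_conj]
  simp

end

theorem stmt11 (n : ℕ) (hn : 1 ≤ n) (u : Fin (n + 1) → ℝ) (hu : ∑ j, (u j) ^ 2 = 1)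
    (hnz : ∀ j, u j ≠ 0) (y : ℝ → ℝ)
    (hyc : ContinuousOn y (Eset u))
    (hyev : ∀ x : ℝ, y (-x) = y x)
    (hy0 : y 0 = 0)
    (hyΦ : ∀ x ∈ Dset u, Phi u x (y x) = 0) :
    Integrable (fun t : ℝ => Fchar u t) ∧
    IntegrableOn (fun s : ℝ => Fchar u (s + Complex.I * y s)) (Eset u) ∧
    (∫ t : ℝ, Fchar u t) = ∫ s in Eset u, Fchar u (s + Complex.I * y s) := by
  have hu1 : ∀ j, |u j| ≤ 1 := by
    intro j
    have h1 : u j ^ 2 ≤ ∑ j, u j ^ 2 :=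
      Finset.single_le_sum (f := fun j => u j ^ 2) (fun j _ => sq_nonneg _) (Finset.mem_univ j)
    exact (sq_le_one_iff_abs_le_one _).1 (hu ▸ h1)
  have hm : 2 ≤ n + 1 := by omega
  obtain ⟨hDm, hint, hval⟩ := integral_re_Fchar_curve hm hnz hu1 hyc hy0 hyΦ
  have hreal : IntegrableOn (fun t : ℝ => Fchar u t) (Set.Ioi 0) := by
    simpa using integrableOn_Fchar_add hm hnz hu1 (t := 0) (by simp) (.inr (by simp))
  obtain ⟨hi1, hv1⟩ := integral_of_conj_symm (f := fun t : ℝ => Fchar u t)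
    (fun x => by rw [← Fchar_neg_conj]; simp) hreal
  have hDE : ∀ x : ℝ, 0 < x → (x ∈ Eset u ↔ x ∈ Dset u) := fun x hx =>
    ⟨fun h => by
      rcases h with h | h | h
      · exact absurd h hx.ne'
      · exact h
      · exact absurd h.1 (by linarith), fun h => Or.inr (Or.inl h)⟩
  have hEneg : ∀ x : ℝ, -x ∈ Eset u ↔ x ∈ Eset u := fun x => by
    simp only [Eset, Set.mem_ofPred_eq, neg_eq_zero, neg_neg]
    rw [or_comm (a := -x ∈ Dset u)]
  have hEm : MeasurableSet (Eset u) :=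
    (measurableSet_singleton (0 : ℝ)).union (hDm.union (measurable_neg hDm))
  have hEqD : Set.Ioi 0 ∩ Eset u = Dset u := by
    ext x
    exact ⟨fun h => (hDE x h.1).1 h.2, fun h => ⟨h.1, (hDE x h.1).2 h⟩⟩
  set f : ℝ → ℂ := fun s => Fchar u (s + Complex.I * y s) with hf
  have hfD : ∀ s ∈ Dset u, f s = (((f s).re : ℝ) : ℂ) := by
    intro s hs
    obtain ⟨r, -, hr⟩ := exists_Fchar_eq_of_Phi_eq_zero hnz hs.1 (hyΦ s hs)
    simp only [hf, hr, Complex.ofReal_re]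
  have hfint : IntegrableOn f (Dset u) :=
    IntegrableOn.congr_fun hint.ofReal (fun s hs => (hfD s hs).symm) hDm
  have hfval : ∫ s in Dset u, f s = ((-(Fprim u 0).re : ℝ) : ℂ) := by
    rw [setIntegral_congr_fun hDm hfD, integral_complex_ofReal, hval]
  obtain ⟨hi2, hv2⟩ := integral_of_conj_symm (f := (Eset u).indicator f) (fun x => by
      by_cases hx : x ∈ Eset u
      · rw [Set.indicator_of_mem hx, Set.indicator_of_mem ((hEneg x).2 hx), ← Fchar_neg_conj]
        simp [hf, hyev]
        ring_nf
      · rw [Set.indicator_of_notMem hx, Set.indicator_of_notMem (mt (hEneg x).1 hx), map_zero])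
    (by
      rw [IntegrableOn, integrable_indicator_iff hEm, IntegrableOn, Measure.restrict_restrict hEm,
        Set.inter_comm, hEqD]
      exact hfint)
  refine ⟨hi1, (integrable_indicator_iff hEm).1 hi2, ?_⟩
  rw [← integral_indicator hEm, hv1, hv2, setIntegral_indicator hEm, hEqD, hfval]
  simp [Fprim]
end

section
/- Define g : (−π, π) → ℂ by g(s) = exp(i·(s + i·(1 − s·cot s))) / (1 + i·(s + i·(1 − s·cot s))) for s ≠ 0 (the value at the single point s = 0 is immaterial for the integral). Then g(s) is a positive real number for every s ∈ (−π, π) with s ≠ 0, and (1/(2π))·∫_{−π}^{π} g(s) ds = 1/e. -/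
open MeasureTheory

/-- `F_v` (for the one-dimensional unit vector `v = (1)`) evaluated along the contour
`s ↦ s + i (1 - s cot s)`. -/
noncomputable def gContour (s : ℝ) : ℂ :=
  Complex.exp (Complex.I * (s + Complex.I * (1 - s * Real.cot s))) /
    (1 + Complex.I * (s + Complex.I * (1 - s * Real.cot s)))

open Filter Topology Set

/-- The Hankel-type contour `s ↦ s cot s + i s`. -/
noncomputable def hankelPath (s : ℝ) : ℂ := ⟨s * Real.cot s, s⟩

/-- The (real) value of `exp w / w` at the point `w = s cot s + i s`. -/
noncomputable def hankelDensity (s : ℝ) : ℝ :=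
  Real.sin s / s * Real.exp (s * Real.cot s)

theorem sin_ne_zero_of_mem_Ioo {s : ℝ} (hs : s ∈ Ioo (-Real.pi) Real.pi) (h0 : s ≠ 0) :
    Real.sin s ≠ 0 := fun h ↦ h0 ((Real.sin_eq_zero_iff_of_lt_of_lt hs.1 hs.2).1 h)

theorem hankelPath_ne_zero {s : ℝ} (h0 : s ≠ 0) : hankelPath s ≠ 0 := fun h ↦
  h0 (by simpa [hankelPath] using congrArg Complex.im h)

theorem exp_hankelPath (s : ℝ) : Complex.exp (hankelPath s) =
    ⟨Real.exp (s * Real.cot s) * Real.cos s, Real.exp (s * Real.cot s) * Real.sin s⟩ := by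
  apply Complex.ext <;> simp [hankelPath, Complex.exp_re, Complex.exp_im]

theorem exp_hankelPath_div {s : ℝ} (h0 : s ≠ 0) (hsin : Real.sin s ≠ 0) :
    Complex.exp (hankelPath s) / hankelPath s = hankelDensity s := by
  rw [div_eq_iff (hankelPath_ne_zero h0), exp_hankelPath]
  apply Complex.ext
  · rw [Complex.re_ofReal_mul]
    simp only [hankelPath, hankelDensity, Real.cot_eq_cos_div_sin]
    field_simp
  · rw [Complex.im_ofReal_mul]
    simp only [hankelPath, hankelDensity]
    field_simp

theorem one_div_hankelPath {s : ℝ} (h0 : s ≠ 0) (hsin : Real.sin s ≠ 0) :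
    1 / hankelPath s = ⟨Real.sin s * Real.cos s / s, -(Real.sin s ^ 2 / s)⟩ := by
  rw [div_eq_iff (hankelPath_ne_zero h0)]
  apply Complex.ext
  · simp [hankelPath, Real.cot_eq_cos_div_sin]
    field_simp
    linarith [Real.sin_sq_add_cos_sq s]
  · simp [hankelPath, Real.cot_eq_cos_div_sin]
    field_simp
    ring

theorem hasDerivAt_hankelPath {s : ℝ} (hsin : Real.sin s ≠ 0) :
    HasDerivAt hankelPath ⟨Real.cot s - s / Real.sin s ^ 2, 1⟩ s := by
  have hre : HasDerivAt (fun x ↦ x * Real.cot x) (Real.cot s - s / Real.sin s ^ 2) s := by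
    simp only [Real.cot_eq_cos_div_sin]
    convert! (hasDerivAt_id s).mul ((Real.hasDerivAt_cos s).div (Real.hasDerivAt_sin s) hsin) using 1
    simp only [id, Pi.div_apply]
    field_simp
    linear_combination s * Real.sin_sq_add_cos_sq s
  have := hre.ofReal_comp.add ((hasDerivAt_id s).ofReal_comp.mul_const Complex.I)
  convert! this using 1
  · ext x
    simp [hankelPath, Complex.mk_eq_add_mul_I]
  · simp [Complex.mk_eq_add_mul_I]

theorem hankelDensity_neg (s : ℝ) : hankelDensity (-s) = hankelDensity s := by
  simp [hankelDensity, Real.cot_eq_cos_div_sin, neg_div, div_neg]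

theorem gContour_eq {s : ℝ} (hs : s ∈ Ioo (-Real.pi) Real.pi) :
    gContour s = (((Real.exp 1)⁻¹ * hankelDensity s : ℝ) : ℂ) := by
  rcases eq_or_ne s 0 with rfl | h0
  · simp [gContour, hankelDensity]
  have h1 : Complex.I * (s + Complex.I * (1 - s * Real.cot s)) = hankelPath s - 1 := by
    rw [hankelPath, Complex.mk_eq_add_mul_I]
    push_cast
    linear_combination (1 - s * Complex.cot s) * Complex.I_mul_I
  rw [gContour, h1, Complex.exp_sub, add_sub_cancel, div_right_comm,
    exp_hankelPath_div h0 (sin_ne_zero_of_mem_Ioo hs h0)]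
  push_cast
  rw [div_eq_inv_mul]

theorem hankelDensity_pos {s : ℝ} (hs : s ∈ Ioo (-Real.pi) Real.pi) (h0 : s ≠ 0) :
    0 < hankelDensity s := by
  refine mul_pos ?_ (Real.exp_pos _)
  rcases h0.lt_or_gt with h | h
  · exact div_pos_of_neg_of_neg (Real.sin_neg_of_neg_of_neg_pi_lt h hs.1) h
  · exact div_pos (Real.sin_pos_of_pos_of_lt_pi h hs.2) h

/-- The entire function `(exp z - 1) / z` has a primitive. -/
theorem exists_hasDerivAt_exp_sub_one_div :
    ∃ h : ℂ → ℂ, Continuous h ∧ ∀ z ≠ 0, HasDerivAt h ((Complex.exp z - 1) / z) z := by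
  have hd : Differentiable ℂ (dslope Complex.exp 0) := by
    rw [← differentiableOn_univ, Complex.differentiableOn_dslope univ_mem]
    exact Complex.differentiable_exp.differentiableOn
  obtain ⟨h, hh⟩ := hd.isExactOn_univ
  refine ⟨h, continuous_iff_continuousAt.2 fun z ↦ (hh z (mem_univ z)).continuousAt, ?_⟩
  intro z hz
  have := hh z (mem_univ z)
  rwa [dslope_of_ne _ hz, slope_def_field, Complex.exp_zero, sub_zero] at this

theorem mul_cot_le_one {s : ℝ} (h0 : 0 < s) (hpi : s < Real.pi) : s * Real.cot s ≤ 1 := by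
  have hsin := Real.sin_pos_of_pos_of_lt_pi h0 hpi
  rw [Real.cot_eq_cos_div_sin, mul_div_assoc', div_le_one hsin]
  rcases lt_or_ge s (Real.pi / 2) with h | h
  · have hcos := Real.cos_pos_of_mem_Ioo ⟨by linarith, h⟩
    have := Real.le_tan h0.le h
    rwa [Real.tan_eq_sin_div_cos, le_div_iff₀ hcos] at this
  · have := Real.cos_nonpos_of_pi_div_two_le_of_le h (by linarith)
    nlinarith

theorem intervalIntegrable_hankelDensity :
    IntervalIntegrable hankelDensity volume 0 Real.pi := by
  rw [intervalIntegrable_iff_integrableOn_Ioo_of_le Real.pi_pos.le]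
  refine Measure.integrableOn_of_bounded (M := Real.exp 1) (by simp) ?_ ?_
  · unfold hankelDensity
    simp only [Real.cot_eq_cos_div_sin]
    exact Measurable.aestronglyMeasurable (by fun_prop)
  · refine (ae_restrict_iff' measurableSet_Ioo).2 (ae_of_all _ fun s hs ↦ ?_)
    have hpos : 0 < hankelDensity s :=
      hankelDensity_pos ⟨by linarith [hs.1, Real.pi_pos], hs.2⟩ hs.1.ne'
    rw [Real.norm_of_nonneg hpos.le, hankelDensity, ← one_mul (Real.exp 1)]
    gcongr
    · rw [div_le_one hs.1]
      exact Real.sin_le hs.1.le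
    · exact mul_cot_le_one hs.1 hs.2

theorem tendsto_hankelPath_zero : Tendsto hankelPath (𝓝[≠] 0) (𝓝 1) := by
  have h1 : Tendsto (fun s : ℝ ↦ ((Real.cos s / Real.sinc s : ℝ) : ℂ) + s * Complex.I)
      (𝓝 0) (𝓝 1) := by
    have : ContinuousAt (fun s : ℝ ↦ ((Real.cos s / Real.sinc s : ℝ) : ℂ) + s * Complex.I) 0 := by
      have : ContinuousAt (fun s : ℝ ↦ Real.cos s / Real.sinc s) 0 :=
        Real.continuous_cos.continuousAt.div Real.continuous_sinc.continuousAt (by simp)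
      fun_prop
    simpa [ContinuousAt] using this
  refine (h1.mono_left nhdsWithin_le_nhds).congr' ?_
  filter_upwards [self_mem_nhdsWithin] with s hs
  rw [hankelPath, Complex.mk_eq_add_mul_I, Real.sinc_of_ne_zero hs, Real.cot_eq_cos_div_sin]
  congr 2
  rw [div_div_eq_mul_div]
  ring

theorem tendsto_mul_cot_pi : Tendsto (fun s ↦ s * Real.cot s) (𝓝[<] Real.pi) atBot := by
  have hsin : Tendsto Real.sin (𝓝[<] Real.pi) (𝓝[>] 0) := by
    refine tendsto_nhdsWithin_iff.2 ⟨?_, ?_⟩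
    · simpa using (Real.continuous_sin.tendsto Real.pi).mono_left nhdsWithin_le_nhds
    · filter_upwards [Ioo_mem_nhdsLT Real.pi_pos] with s hs
      exact Real.sin_pos_of_pos_of_lt_pi hs.1 hs.2
  have hcos : Tendsto (fun s ↦ s * Real.cos s) (𝓝[<] Real.pi) (𝓝 (-Real.pi)) := by
    have : Continuous fun s ↦ s * Real.cos s := by fun_prop
    simpa using (this.tendsto Real.pi).mono_left nhdsWithin_le_nhds
  refine (hcos.neg_mul_atTop (by linarith [Real.pi_pos]) hsin.inv_tendsto_nhdsGT_zero).congr ?_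
  intro s
  simp [Real.cot_eq_cos_div_sin, div_eq_mul_inv, mul_assoc]

theorem norm_exp_sub_one_div_le {a : ℝ} (ha : a < 0) {z : ℂ} (hz : z.re ≤ a) :
    ‖(Complex.exp z - 1) / z‖ ≤ 2 / (-a) := by
  rw [norm_div]
  gcongr
  · linarith
  · refine (norm_sub_le _ _).trans ?_
    have : Real.exp z.re ≤ 1 := Real.exp_le_one_iff.2 (by linarith)
    rw [Complex.norm_exp, norm_one]
    linarith
  · linarith [neg_abs_le z.re, Complex.abs_re_le_norm z]

theorem hankelPath_sub_hankelPath_neg (s : ℝ) :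
    hankelPath s - hankelPath (-s) = 2 * s * Complex.I := by
  apply Complex.ext <;> simp [hankelPath, Real.cot_eq_cos_div_sin, div_neg]
  ring

theorem tendsto_primitive_sub_pi {h : ℂ → ℂ}
    (hd : ∀ z ≠ 0, HasDerivAt h ((Complex.exp z - 1) / z) z) :
    Tendsto (fun s ↦ h (hankelPath s) - h (hankelPath (-s))) (𝓝[<] Real.pi) (𝓝 0) := by
  have hlim : Tendsto (fun s ↦ 2 / (-(s * Real.cot s)) * (2 * Real.pi)) (𝓝[<] Real.pi) (𝓝 0) := by
    simpa using ((tendsto_neg_atBot_atTop.comp tendsto_mul_cot_pi).const_div_atTop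
      2).mul_const (2 * Real.pi)
  refine squeeze_zero_norm' ?_ hlim
  filter_upwards [tendsto_mul_cot_pi.eventually_lt_atBot 0, Ioo_mem_nhdsLT Real.pi_pos]
    with s hneg hs
  have hmem : ∀ t : ℝ, t = s ∨ t = -s → hankelPath t ∈ {z : ℂ | z.re ≤ s * Real.cot s} := by
    rintro t (rfl | rfl) <;> simp [hankelPath, Real.cot_eq_cos_div_sin, div_neg]
  have := (convex_halfSpace_re_le (s * Real.cot s)).norm_image_sub_le_of_norm_hasDerivWithin_le
    (f := h) (f' := fun z ↦ (Complex.exp z - 1) / z)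
    (fun z hz ↦ (hd z fun h0 ↦ by
      have hz' : z.re ≤ s * Real.cot s := hz
      rw [h0, Complex.zero_re] at hz'
      linarith).hasDerivWithinAt)
    (fun z hz ↦ norm_exp_sub_one_div_le hneg hz) (hmem (-s) (.inr rfl)) (hmem s (.inl rfl))
  refine this.trans ?_
  rw [hankelPath_sub_hankelPath_neg]
  have h2 : ‖(2 * s * Complex.I : ℂ)‖ = 2 * s := by simp [abs_of_pos hs.1]
  rw [h2]
  have : 0 < 2 / (-(s * Real.cot s)) := by
    have : 0 < -(s * Real.cot s) := by linarith
    positivity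
  gcongr
  exact hs.2.le

theorem exists_hasDerivAt_primitive_comp {h : ℂ → ℂ}
    (hd : ∀ z ≠ 0, HasDerivAt h ((Complex.exp z - 1) / z) z) {s : ℝ} (h0 : s ≠ 0)
    (hsin : Real.sin s ≠ 0) :
    ∃ d : ℂ, HasDerivAt (fun x ↦ h (hankelPath x)) d s ∧ d.im = hankelDensity s - 1 := by
  refine ⟨_, (hd _ (hankelPath_ne_zero h0)).comp s (hasDerivAt_hankelPath hsin), ?_⟩
  rw [sub_div, exp_hankelPath_div h0 hsin, one_div_hankelPath h0 hsin]
  simp [Real.cot_eq_cos_div_sin]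
  field_simp
  ring

theorem integral_hankelDensity : ∫ s in (0 : ℝ)..Real.pi, hankelDensity s = Real.pi := by
  obtain ⟨h, hc, hd⟩ := exists_hasDerivAt_exp_sub_one_div
  have key := intervalIntegral.integral_eq_sub_of_hasDerivAt_of_tendsto
    (f := fun s ↦ s + (h (hankelPath s) - h (hankelPath (-s))).im / 2) (fa := 0)
    (fb := Real.pi) Real.pi_pos ?_ intervalIntegrable_hankelDensity ?_ ?_
  · simpa using key
  · intro s hs
    have hsin := (Real.sin_pos_of_pos_of_lt_pi hs.1 hs.2).ne'
    obtain ⟨d, hd1, hd2⟩ := exists_hasDerivAt_primitive_comp hd hs.1.ne' hsin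
    obtain ⟨e, he1, he2⟩ := exists_hasDerivAt_primitive_comp hd (s := -s)
      (neg_ne_zero.2 hs.1.ne') (by simpa using hsin)
    have he3 := he1.scomp s (hasDerivAt_neg s)
    have := (hasDerivAt_id s).add
      ((Complex.imCLM.hasFDerivAt.comp_hasDerivAt s (hd1.sub he3)).div_const 2)
    convert! this using 1
    simp [hd2, he2, hankelDensity_neg]
  · have hp : Tendsto (fun s ↦ h (hankelPath s)) (𝓝[≠] 0) (𝓝 (h 1)) :=
      (hc.tendsto 1).comp tendsto_hankelPath_zero
    have hneg : Tendsto (fun s : ℝ ↦ -s) (𝓝[≠] 0) (𝓝[≠] 0) := by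
      refine tendsto_nhdsWithin_iff.2 ⟨?_, ?_⟩
      · simpa using (continuous_neg.tendsto (0 : ℝ)).mono_left nhdsWithin_le_nhds
      · filter_upwards [self_mem_nhdsWithin] with s hs
        simpa using hs
    have := (Complex.continuous_im.tendsto _).comp (hp.sub (hp.comp hneg))
    have hid : Tendsto (fun s : ℝ ↦ s) (𝓝[≠] 0) (𝓝 0) := nhdsWithin_le_nhds
    simpa using (hid.add (this.div_const 2)).mono_left (nhdsGT_le_nhdsNE 0)
  · have := (Complex.continuous_im.tendsto _).comp (tendsto_primitive_sub_pi hd)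
    have hid : Tendsto (fun s : ℝ ↦ s) (𝓝[<] Real.pi) (𝓝 Real.pi) := nhdsWithin_le_nhds
    simpa using hid.add (this.div_const 2)

theorem integral_hankelDensity_symm :
    ∫ s in (-Real.pi)..Real.pi, hankelDensity s = 2 * Real.pi := by
  have hint := intervalIntegrable_hankelDensity
  have hneg : IntervalIntegrable hankelDensity volume (-Real.pi) 0 := by
    rw [IntervalIntegrable.iff_comp_neg]
    simpa [hankelDensity_neg] using hint.symm
  have h1 : ∫ s in (-Real.pi)..0, hankelDensity s = Real.pi := by
    simpa [hankelDensity_neg, integral_hankelDensity] using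
      (intervalIntegral.integral_comp_neg (a := 0) (b := Real.pi) hankelDensity).symm
  rw [← intervalIntegral.integral_add_adjacent_intervals hneg hint, h1, integral_hankelDensity]
  ring

theorem stmt14 :
    (∀ s ∈ Set.Ioo (-Real.pi) Real.pi, s ≠ 0 →
      (gContour s).im = 0 ∧ 0 < (gContour s).re) ∧
    (1 / (2 * Real.pi) : ℂ) * (∫ s in Set.Ioo (-Real.pi) Real.pi, gContour s) =
      ((Real.exp 1)⁻¹ : ℝ) := by
  refine ⟨fun s hs h0 ↦ ?_, ?_⟩
  · rw [gContour_eq hs, Complex.ofReal_im, Complex.ofReal_re]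
    exact ⟨rfl, mul_pos (inv_pos.2 (Real.exp_pos 1)) (hankelDensity_pos hs h0)⟩
  · rw [setIntegral_congr_fun measurableSet_Ioo fun s hs ↦ gContour_eq hs, integral_complex_ofReal,
      integral_const_mul, ← integral_Ioc_eq_integral_Ioo,
      ← intervalIntegral.integral_of_le (by linarith [Real.pi_pos]), integral_hankelDensity_symm]
    have : (Real.pi : ℂ) ≠ 0 := Complex.ofReal_ne_zero.2 Real.pi_ne_zero
    push_cast
    field_simp
end
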